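/- Let γ : S^n → ℝ be positive and such that its positively 1-homogeneous extension γ̄ is twice continuously differentiable on ℝ^{n+1} \ {0}. Assume γ is uniformly convex, i.e. for every ν ∈ S^n and every nonzero u ∈ ℝ^{n+1} with ⟨u, ν⟩ = 0 one has D²γ̄(ν)(u, u) > 0. Then the Cahn-Hoffman map ξ_γ = ∇γ̄ restricted to S^n is injective, its image ξ_γ(S^n) equals the Wulff shape W_γ (the frontier of W̃[γ]), and for each ν ∈ S^n: ⟨ξ_γ(ν), ν⟩ = γ(ν) and ⟨x, ν⟩ ≤ γ(ν) for all x ∈ W̃[γ] (so γ is the support function of W_γ and ν is the outward normal at ξ_γ(ν)). (Paper's Theorem 4.5 (iii).) -/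

import Mathlib

open scoped RealInnerProductSpace

/-- The Wulff body `W̃[γ] = ⋂_{‖ν‖=1} {x : ⟨x,ν⟩ ≤ γ(ν)}`, where `γ'` is the
1-homogeneous extension of the integrand `γ` (so `γ' ν = γ ν` on the unit sphere). -/
def wulffBody (n : ℕ) (γ' : EuclideanSpace ℝ (Fin (n + 1)) → ℝ) :
    Set (EuclideanSpace ℝ (Fin (n + 1))) :=
  ⋂ ν ∈ Metric.sphere (0 : EuclideanSpace ℝ (Fin (n + 1))) 1, {x | ⟪x, ν⟫ ≤ γ' ν}

section Homogeneous

variable {E : Type*} [NormedAddCommGroup E] [NormedSpace ℝ E] {f : E → ℝ}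

/-- Euler's identity for positively 1-homogeneous functions. -/
theorem fderiv_apply_self_of_posHomogeneous
    (hhom : ∀ r : ℝ, 0 ≤ r → ∀ x : E, f (r • x) = r * f x) {x : E}
    (hf : DifferentiableAt ℝ f x) : fderiv ℝ f x x = f x := by
  have hline : HasDerivAt (fun r : ℝ => r • x) x 1 := by
    simpa using (hasDerivAt_id (1 : ℝ)).smul_const x
  have h1 : HasDerivAt (fun r : ℝ => f (r • x)) (fderiv ℝ f x x) 1 :=
    HasFDerivAt.comp_hasDerivAt (1 : ℝ) (by simpa using hf.hasFDerivAt) hline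
  have h2 : HasDerivAt (fun r : ℝ => f (r • x)) (f x) 1 := by
    have h3 : HasDerivAt (fun r : ℝ => r * f x) (f x) 1 := by
      simpa using (hasDerivAt_id (1 : ℝ)).mul_const (f x)
    refine h3.congr_of_eventuallyEq ?_
    filter_upwards [Ioi_mem_nhds (zero_lt_one (α := ℝ))] with r hr
    exact hhom r (le_of_lt hr) x
  exact h1.unique h2

/-- The derivative of a positively 1-homogeneous function is positively 0-homogeneous. -/
theorem fderiv_smul_of_posHomogeneous
    (hhom : ∀ r : ℝ, 0 ≤ r → ∀ x : E, f (r • x) = r * f x) {r : ℝ} (hr : 0 < r) (x : E) :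
    fderiv ℝ f (r • x) = fderiv ℝ f x := by
  have h1 : fderiv ℝ (fun y => f (r • y)) x = r • fderiv ℝ f (r • x) := fderiv_comp_smul ..
  have h2 : (fun y => f (r • y)) = r • f := by
    ext y; simp [hhom r hr.le y]
  rw [h2, fderiv_const_smul_field] at h1
  exact (smul_right_injective _ hr.ne' h1).symm

/-- The second derivative of a positively 1-homogeneous function is positively homogeneous of
degree `-1`. -/
theorem smul_fderiv_fderiv_smul_of_posHomogeneous
    (hhom : ∀ r : ℝ, 0 ≤ r → ∀ x : E, f (r • x) = r * f x) {r : ℝ} (hr : 0 < r) (x : E) :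
    r • fderiv ℝ (fderiv ℝ f) (r • x) = fderiv ℝ (fderiv ℝ f) x := by
  rw [← fderiv_comp_smul]
  congr 1
  ext1 y
  exact fderiv_smul_of_posHomogeneous hhom hr y

/-- The radial direction lies in the kernel of the second derivative of a positively
1-homogeneous function. -/
theorem fderiv_fderiv_apply_self_of_posHomogeneous
    (hhom : ∀ r : ℝ, 0 ≤ r → ∀ x : E, f (r • x) = r * f x) {x : E}
    (hf : DifferentiableAt ℝ (fderiv ℝ f) x) : fderiv ℝ (fderiv ℝ f) x x = 0 := by
  have hline : HasDerivAt (fun r : ℝ => r • x) x 1 := by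
    simpa using (hasDerivAt_id (1 : ℝ)).smul_const x
  have h1 : HasDerivAt (fun r : ℝ => fderiv ℝ f (r • x)) (fderiv ℝ (fderiv ℝ f) x x) 1 :=
    HasFDerivAt.comp_hasDerivAt (1 : ℝ) (by simpa using hf.hasFDerivAt) hline
  have h2 : HasDerivAt (fun r : ℝ => fderiv ℝ f (r • x)) 0 1 := by
    refine (hasDerivAt_const (1 : ℝ) (fderiv ℝ f x)).congr_of_eventuallyEq ?_
    filter_upwards [Ioi_mem_nhds (zero_lt_one (α := ℝ))] with r hr
    exact fderiv_smul_of_posHomogeneous hhom hr x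
  exact h1.unique h2

/-- If the second derivative of `f` is positive in direction `w` along the segment from `x` to
`x + w`, then `f` lies strictly above its tangent at `x` at the point `x + w`. -/
theorem add_fderiv_lt_of_fderiv_fderiv_pos {x w : E}
    (hf : ∀ t ∈ Set.Icc (0 : ℝ) 1, ContDiffAt ℝ 2 f (x + t • w))
    (hpos : ∀ t ∈ Set.Icc (0 : ℝ) 1, 0 < fderiv ℝ (fderiv ℝ f) (x + t • w) w w) :
    f x + fderiv ℝ f x w < f (x + w) := by
  have hline (t : ℝ) : HasDerivAt (fun t : ℝ => x + t • w) w t := by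
    simpa using ((hasDerivAt_id t).smul_const w).const_add x
  have h1 (t : ℝ) (ht : t ∈ Set.Icc (0 : ℝ) 1) :
      HasDerivAt (fun t : ℝ => f (x + t • w)) (fderiv ℝ f (x + t • w) w) t :=
    ((hf t ht).differentiableAt (by norm_num)).hasFDerivAt.comp_hasDerivAt t (hline t)
  have h2 (t : ℝ) (ht : t ∈ Set.Icc (0 : ℝ) 1) :
      HasDerivAt (fun t : ℝ => fderiv ℝ f (x + t • w) w)
        (fderiv ℝ (fderiv ℝ f) (x + t • w) w w) t := by
    have hd : DifferentiableAt ℝ (fderiv ℝ f) (x + t • w) :=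
      ((hf t ht).fderiv_right (m := 1) (by norm_num)).differentiableAt (by norm_num)
    have hcomp : HasDerivAt (fun t : ℝ => fderiv ℝ f (x + t • w))
        (fderiv ℝ (fderiv ℝ f) (x + t • w) w) t :=
      hd.hasFDerivAt.comp_hasDerivAt t (hline t)
    simpa using hcomp.clm_apply (hasDerivAt_const t w)
  obtain ⟨c, hc, hcs⟩ := exists_hasDerivAt_eq_slope (fun t : ℝ => f (x + t • w))
    (fun t => fderiv ℝ f (x + t • w) w) (zero_lt_one (α := ℝ))
    (fun t ht => (h1 t ht).continuousAt.continuousWithinAt)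
    (fun t ht => h1 t (Set.Ioo_subset_Icc_self ht))
  have hsub : Set.Icc 0 c ⊆ Set.Icc (0 : ℝ) 1 := Set.Icc_subset_Icc_right hc.2.le
  obtain ⟨d, hd, hds⟩ := exists_hasDerivAt_eq_slope (fun t : ℝ => fderiv ℝ f (x + t • w) w)
    (fun t => fderiv ℝ (fderiv ℝ f) (x + t • w) w w) hc.1
    (fun t ht => (h2 t (hsub ht)).continuousAt.continuousWithinAt)
    (fun t ht => h2 t (hsub (Set.Ioo_subset_Icc_self ht)))
  have hp := hpos d (hsub (Set.Ioo_subset_Icc_self hd))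
  rw [hds, div_pos_iff_of_pos_right (by linarith [hc.1])] at hp
  simp only [zero_smul, add_zero, one_smul, sub_zero, div_one] at hcs hp
  linarith

end Homogeneous

section Convex

variable {E : Type*} [NormedAddCommGroup E] [InnerProductSpace ℝ E] {f : E → ℝ}

/-- For a uniformly convex integrand, the second derivative of the homogeneous extension is
positive in every non-radial direction. -/
theorem fderiv_fderiv_pos_of_not_radial
    (hhom : ∀ r : ℝ, 0 ≤ r → ∀ x : E, f (r • x) = r * f x)
    (hf : ∀ x : E, x ≠ 0 → ContDiffAt ℝ 2 f x)
    (huc : ∀ ν : E, ‖ν‖ = 1 → ∀ u : E, u ≠ 0 → ⟪u, ν⟫ = 0 →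
      0 < fderiv ℝ (fderiv ℝ f) ν u u)
    {z w : E} (hz : z ≠ 0) (hw : ∀ c : ℝ, w ≠ c • z) :
    0 < fderiv ℝ (fderiv ℝ f) z w w := by
  have hn : 0 < ‖z‖ := norm_pos_iff.2 hz
  set c : ℝ := ⟪w, z⟫ / ‖z‖ ^ 2
  have hu : w - c • z ≠ 0 := sub_ne_zero.2 (hw c)
  have horth : ⟪w - c • z, z⟫ = 0 := by
    rw [inner_sub_left, real_inner_smul_left, real_inner_self_eq_norm_sq]
    simp only [c]
    field_simp
    ring
  have hker : fderiv ℝ (fderiv ℝ f) z z = 0 :=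
    fderiv_fderiv_apply_self_of_posHomogeneous hhom
      (((hf z hz).fderiv_right (m := 1) (by norm_num)).differentiableAt (by norm_num))
  have hsymm : IsSymmSndFDerivAt ℝ f z := (hf z hz).isSymmSndFDerivAt (by simp)
  have hdec : fderiv ℝ (fderiv ℝ f) z w w =
      fderiv ℝ (fderiv ℝ f) z (w - c • z) (w - c • z) := by
    have h1 : fderiv ℝ (fderiv ℝ f) z w z = 0 := by rw [hsymm.eq, hker]; rfl
    simp [hker, h1]
  have hunit := huc (‖z‖⁻¹ • z) (by rw [norm_smul, norm_inv, norm_norm, inv_mul_cancel₀ hn.ne'])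
    (w - c • z) hu (by rw [real_inner_smul_right, horth, mul_zero])
  rw [hdec, ← smul_fderiv_fderiv_smul_of_posHomogeneous hhom (inv_pos.2 hn) z]
  exact mul_pos (inv_pos.2 hn) hunit

/-- For a positive, uniformly convex integrand, the supporting hyperplane of the Wulff body with
unit normal `μ` lies strictly beyond the Cahn-Hoffman image of every other unit vector `ν`. -/
theorem fderiv_apply_lt_of_uniformly_convex
    (hhom : ∀ r : ℝ, 0 ≤ r → ∀ x : E, f (r • x) = r * f x)
    (hpos : ∀ ν : E, ‖ν‖ = 1 → 0 < f ν)
    (hf : ∀ x : E, x ≠ 0 → ContDiffAt ℝ 2 f x)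
    (huc : ∀ ν : E, ‖ν‖ = 1 → ∀ u : E, u ≠ 0 → ⟪u, ν⟫ = 0 →
      0 < fderiv ℝ (fderiv ℝ f) ν u u)
    {ν μ : E} (hν : ‖ν‖ = 1) (hμ : ‖μ‖ = 1) (hne : ν ≠ μ) :
    fderiv ℝ f ν μ < f μ := by
  have hν0 : ν ≠ 0 := norm_ne_zero_iff.1 (by rw [hν]; exact one_ne_zero)
  have heuler : fderiv ℝ f ν ν = f ν :=
    fderiv_apply_self_of_posHomogeneous hhom ((hf ν hν0).differentiableAt (by norm_num))
  by_cases hanti : μ = -ν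
  · have h1 := hpos ν hν
    have h2 := hpos μ hμ
    have h3 : fderiv ℝ f ν μ = -f ν := by rw [hanti, map_neg, heuler]
    linarith
  -- unit vectors with a common multiple coincide up to sign
  have hpar (a b : ℝ) (z : E) (ha : ν = a • z) (hb : μ = b • z) : False := by
    have hna := congrArg norm ha
    have hnb := congrArg norm hb
    rw [norm_smul, hν, Real.norm_eq_abs] at hna
    rw [norm_smul, hμ, Real.norm_eq_abs] at hnb
    have hz : ‖z‖ ≠ 0 := fun h => by simp [h] at hna
    rcases abs_eq_abs.1 (mul_right_cancel₀ hz (hna.symm.trans hnb)) with h | h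
    · exact hne (by rw [ha, hb, h])
    · exact hanti (by rw [ha, hb, h, neg_smul, neg_neg])
  have hz (t : ℝ) : ν + t • (μ - ν) ≠ 0 := by
    intro h
    have h1 : (1 - t) • ν = (-t) • μ := by linear_combination (norm := module) h
    by_cases ht : t = 0
    · simp [ht] at h1; exact hν0 h1
    · refine hpar 1 (-(t⁻¹ * (1 - t))) ν (one_smul _ _).symm ?_
      rw [neg_smul, mul_smul, h1, smul_smul, ← neg_smul]
      field_simp
      simp
  have key := add_fderiv_lt_of_fderiv_fderiv_pos (f := f) (x := ν) (w := μ - ν)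
    (fun t _ => hf _ (hz t)) (fun t _ => fderiv_fderiv_pos_of_not_radial hhom hf huc (hz t) ?_)
  · rw [map_sub, heuler, add_sub_cancel, add_sub_cancel] at key
    exact key
  · intro c hc
    refine hpar (1 - t * c) (1 - t * c + c) (ν + t • (μ - ν)) ?_ ?_
    · linear_combination (norm := module) (-t) • hc
    · linear_combination (norm := module) (1 - t) • hc

end Convex

section Wulff

variable {n : ℕ} {γ' : EuclideanSpace ℝ (Fin (n + 1)) → ℝ}

theorem mem_wulffBody_iff {x : EuclideanSpace ℝ (Fin (n + 1))} :
    x ∈ wulffBody n γ' ↔ ∀ ν : EuclideanSpace ℝ (Fin (n + 1)), ‖ν‖ = 1 → ⟪x, ν⟫ ≤ γ' ν := by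
  simp [wulffBody]

theorem isClosed_wulffBody : IsClosed (wulffBody n γ') :=
  isClosed_biInter fun _ _ => isClosed_le (by fun_prop) continuous_const

/-- A point of the Wulff body is on the Wulff shape iff it lies on one of the hyperplanes defining
the Wulff body. -/
theorem mem_frontier_wulffBody_iff
    (hcont : ContinuousOn γ' (Metric.sphere (0 : EuclideanSpace ℝ (Fin (n + 1))) 1))
    {x : EuclideanSpace ℝ (Fin (n + 1))} :
    x ∈ frontier (wulffBody n γ') ↔
      x ∈ wulffBody n γ' ∧ ∃ ν : EuclideanSpace ℝ (Fin (n + 1)), ‖ν‖ = 1 ∧ ⟪x, ν⟫ = γ' ν := by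
  rw [isClosed_wulffBody.frontier_eq, Set.mem_sdiff]
  refine and_congr_right fun hx => ?_
  constructor
  · intro hint
    obtain ⟨ν, hν, hmin⟩ := (isCompact_sphere (0 : EuclideanSpace ℝ (Fin (n + 1))) 1).exists_isMinOn
      (NormedSpace.sphere_nonempty.2 zero_le_one)
      (hcont.sub (f := γ') (g := fun ν => ⟪x, ν⟫) (by fun_prop))
    rw [mem_sphere_zero_iff_norm] at hν
    refine ⟨ν, hν, le_antisymm (mem_wulffBody_iff.1 hx ν hν) (not_lt.1 fun hlt => hint ?_)⟩
    rw [mem_interior_iff_mem_nhds, Metric.mem_nhds_iff]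
    refine ⟨γ' ν - ⟪x, ν⟫, sub_pos.2 hlt, fun y hy => mem_wulffBody_iff.2 fun μ hμ => ?_⟩
    have h1 : γ' ν - ⟪x, ν⟫ ≤ γ' μ - ⟪x, μ⟫ := hmin (mem_sphere_zero_iff_norm.2 hμ)
    have h2 : ⟪y - x, μ⟫ ≤ ‖y - x‖ := by simpa [hμ] using real_inner_le_norm (y - x) μ
    rw [mem_ball_iff_norm] at hy
    rw [inner_sub_left] at h2
    linarith
  · rintro ⟨ν, hν, heq⟩ hint
    rw [mem_interior_iff_mem_nhds, Metric.mem_nhds_iff] at hint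
    obtain ⟨ε, hε, hball⟩ := hint
    have hmem : x + (ε / 2) • ν ∈ wulffBody n γ' := hball (by
      rw [mem_ball_iff_norm, add_sub_cancel_left, norm_smul, hν, Real.norm_of_nonneg (by positivity)]
      linarith)
    have h := mem_wulffBody_iff.1 hmem ν hν
    rw [inner_add_left, real_inner_smul_left, real_inner_self_eq_norm_sq, hν, heq] at h
    linarith

/-- A point of the Wulff body on the supporting hyperplane with normal `ν` is the Cahn-Hoffman
image of `ν`. -/
theorem gradient_eq_of_mem_wulffBody
    (hhom : ∀ r : ℝ, 0 ≤ r → ∀ x : EuclideanSpace ℝ (Fin (n + 1)), γ' (r • x) = r * γ' x)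
    {x ν : EuclideanSpace ℝ (Fin (n + 1))} (hd : DifferentiableAt ℝ γ' ν)
    (hx : x ∈ wulffBody n γ') (heq : ⟪x, ν⟫ = γ' ν) : gradient γ' ν = x := by
  have hle (y : EuclideanSpace ℝ (Fin (n + 1))) : ⟪x, y⟫ ≤ γ' y := by
    by_cases hy : y = 0
    · have := hhom 0 le_rfl 0
      simp_all
    · have hn : 0 < ‖y‖ := norm_pos_iff.2 hy
      have h := mem_wulffBody_iff.1 hx (‖y‖⁻¹ • y)
        (by rw [norm_smul, norm_inv, norm_norm, inv_mul_cancel₀ hn.ne'])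
      rw [hhom _ (inv_pos.2 hn).le, real_inner_smul_right] at h
      exact le_of_mul_le_mul_left h (inv_pos.2 hn)
  have hmin : IsLocalMin (fun y => γ' y - innerSL ℝ x y) ν :=
    Filter.Eventually.of_forall fun y => by
      have := hle y
      simp only [innerSL_apply_apply, heq]
      linarith
  have hzero := hmin.hasFDerivAt_eq_zero (hd.hasFDerivAt.sub (innerSL ℝ x).hasFDerivAt)
  refine ext_inner_right ℝ fun v => ?_
  rw [inner_gradient_left, sub_eq_zero.1 hzero, innerSL_apply_apply]

end Wulff

/-- Let `γ : S^n → ℝ` be positive with 1-homogeneous extension `γ̄` of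
class C² away from the origin, and assume `γ` is uniformly convex:
`D²γ̄(ν)(u,u) > 0` for all unit `ν` and nonzero `u ⊥ ν`. Then the Cahn-Hoffman map
`ξ_γ = ∇γ̄` is injective on the unit sphere, its image equals the Wulff shape `W_γ`
(the frontier of the Wulff body), and for each unit `ν`: `⟨ξ_γ(ν), ν⟩ = γ(ν)` and
`⟨x, ν⟩ ≤ γ(ν)` for all `x` in the Wulff body. (Paper's Theorem 4.5 (iii).) -/
theorem cahnHoffman_embedding_of_uniformly_convex
    (n : ℕ) (γ' : EuclideanSpace ℝ (Fin (n + 1)) → ℝ)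
    (hhom : ∀ r : ℝ, 0 ≤ r → ∀ x : EuclideanSpace ℝ (Fin (n + 1)), γ' (r • x) = r * γ' x)
    (hpos : ∀ ν : EuclideanSpace ℝ (Fin (n + 1)), ‖ν‖ = 1 → 0 < γ' ν)
    (hC2 : ContDiffOn ℝ 2 γ' {(0 : EuclideanSpace ℝ (Fin (n + 1)))}ᶜ)
    (huc : ∀ ν : EuclideanSpace ℝ (Fin (n + 1)), ‖ν‖ = 1 →
      ∀ u : EuclideanSpace ℝ (Fin (n + 1)), u ≠ 0 → ⟪u, ν⟫ = 0 →
        0 < fderiv ℝ (fderiv ℝ γ') ν u u) :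
    Set.InjOn (gradient γ') (Metric.sphere (0 : EuclideanSpace ℝ (Fin (n + 1))) 1) ∧
    gradient γ' '' Metric.sphere (0 : EuclideanSpace ℝ (Fin (n + 1))) 1 =
      frontier (wulffBody n γ') ∧
    ∀ ν ∈ Metric.sphere (0 : EuclideanSpace ℝ (Fin (n + 1))) 1,
      ⟪gradient γ' ν, ν⟫ = γ' ν ∧ ∀ x ∈ wulffBody n γ', ⟪x, ν⟫ ≤ γ' ν := by
  have hC (x : EuclideanSpace ℝ (Fin (n + 1))) (hx : x ≠ 0) : ContDiffAt ℝ 2 γ' x :=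
    hC2.contDiffAt (isOpen_compl_singleton.mem_nhds hx)
  have hne (ν : EuclideanSpace ℝ (Fin (n + 1))) (hν : ‖ν‖ = 1) : ν ≠ 0 :=
    norm_ne_zero_iff.1 (by rw [hν]; exact one_ne_zero)
  have hd (ν : EuclideanSpace ℝ (Fin (n + 1))) (hν : ‖ν‖ = 1) : DifferentiableAt ℝ γ' ν :=
    (hC ν (hne ν hν)).differentiableAt (by norm_num)
  have hself (ν : EuclideanSpace ℝ (Fin (n + 1))) (hν : ‖ν‖ = 1) :
      ⟪gradient γ' ν, ν⟫ = γ' ν := by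
    rw [inner_gradient_left, fderiv_apply_self_of_posHomogeneous hhom (hd ν hν)]
  have hlt (ν μ : EuclideanSpace ℝ (Fin (n + 1))) (hν : ‖ν‖ = 1) (hμ : ‖μ‖ = 1) (h : ν ≠ μ) :
      ⟪gradient γ' ν, μ⟫ < γ' μ := by
    rw [inner_gradient_left]
    exact fderiv_apply_lt_of_uniformly_convex hhom hpos hC huc hν hμ h
  have hcont : ContinuousOn γ' (Metric.sphere (0 : EuclideanSpace ℝ (Fin (n + 1))) 1) :=
    fun ν hν => (hd ν (mem_sphere_zero_iff_norm.1 hν)).continuousAt.continuousWithinAt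
  refine ⟨fun ν hν μ hμ h => ?_, ?_, fun ν hν => ?_⟩
  · rw [mem_sphere_zero_iff_norm] at hν hμ
    by_contra hνμ
    have h1 := hlt ν μ hν hμ hνμ
    rw [h, hself μ hμ] at h1
    exact lt_irrefl _ h1
  · ext x
    rw [mem_frontier_wulffBody_iff hcont]
    constructor
    · rintro ⟨ν, hν, rfl⟩
      rw [mem_sphere_zero_iff_norm] at hν
      refine ⟨mem_wulffBody_iff.2 fun μ hμ => ?_, ν, hν, hself ν hν⟩
      by_cases h : ν = μ
      · exact h ▸ (hself ν hν).le
      · exact (hlt ν μ hν hμ h).le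
    · rintro ⟨hx, ν, hν, heq⟩
      exact ⟨ν, mem_sphere_zero_iff_norm.2 hν,
        gradient_eq_of_mem_wulffBody hhom (hd ν hν) hx heq⟩
  · rw [mem_sphere_zero_iff_norm] at hν
    exact ⟨hself ν hν, fun x hx => mem_wulffBody_iff.1 hx ν hν⟩
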